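/- For every $h \ge 2$, the convexity deficit of the spiral code $w(h-2)$ of the spiral benzenoid $S(h)$ equals $\max\{h - 2,\ 2h - 8\}$. -/

import Mathlib

/-- A code is a string over the alphabet `{1,2,3,4,5}`. -/
def IsCode (c : List ℕ) : Prop := ∀ x ∈ c, 1 ≤ x ∧ x ≤ 5

/-- The cyclic window of length `m` in a code `c` starting at position `i`:
the string of `m` cyclically consecutive entries of `c` beginning at index `i`. -/
def cwin (c : List ℕ) (i m : ℕ) : List ℕ := (c.rotate i).take m

/-- A code `c` is `k`-convex if every cyclic window of length `k + 1`
(such windows exist when `k + 1 ≤ len c`) has sum at least `2 * (k + 1)`,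
i.e. average value at least `2`. -/
def KConvex (c : List ℕ) (k : ℕ) : Prop :=
  ∀ i < c.length, k + 1 ≤ c.length → 2 * (k + 1) ≤ (cwin c i (k + 1)).sum

/-- The convexity deficit of a code: the minimum `k ≥ 0` such that `c` is `k`-convex. -/
noncomputable def cd (c : List ℕ) : ℕ := sInf {k | KConvex c k}

/-- The winding of a code: the sum of its entries minus twice its length. -/
def win (c : List ℕ) : ℤ := (c.sum : ℤ) - 2 * c.length

/-- The `k`-th block `(2^k 3)^3` of the infinite code
`a = ⊕_{k=0}^∞ (2^k 3)^3 = 33323232322322322322232223…`. -/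
def blockA (k : ℕ) : List ℕ := (List.replicate 3 (List.replicate k 2 ++ [3])).flatten

/-- The `k`-th block `(2^k 1)^3` of the infinite code
`b = ⊕_{k=0}^∞ (2^k 1)^3 = 11121212122122122122212221…`. -/
def blockB (k : ℕ) : List ℕ := (List.replicate 3 (List.replicate k 2 ++ [1])).flatten

/-- `a l`: the first `l` symbols of the infinite code `a`.
(The concatenation of the first `l` blocks has length `3 * l * (l + 1) / 2 ≥ l`,
so truncating it to `l` symbols yields exactly the first `l` symbols of `a`.) -/
def aPrefix (l : ℕ) : List ℕ := (((List.range l).map blockA).flatten).take l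

/-- `b l`: the first `l` symbols of the infinite code `b`. -/
def bPrefix (l : ℕ) : List ℕ := (((List.range l).map blockB).flatten).take l

/-- The boundary-edges code `w l = 5 ⊕ a(l) ⊕ 5 ⊕ ρ(b(l))` of the spiral
benzenoid `S (l + 2)` on `l + 2` hexagons. -/
def spiralCode (l : ℕ) : List ℕ := 5 :: aPrefix l ++ 5 :: (bPrefix l).reverse

/-- A list of numbers at most `3`, starting with `2` unless empty, with consecutive entries
summing to at most `5`. -/
def IsSparse (c : List ℕ) : Prop :=
  c.IsChain (fun x y => x + y ≤ 5) ∧ (∀ x ∈ c, x ≤ 3) ∧ ∀ x ∈ c.head?, x = 2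

theorem IsSparse.append {c d : List ℕ} (hc : IsSparse c) (hd : IsSparse d) :
    IsSparse (c ++ d) := by
  obtain ⟨c1, c2, c3⟩ := hc
  obtain ⟨d1, d2, d3⟩ := hd
  refine ⟨List.isChain_append.2 ⟨c1, d1, fun x hx y hy => ?_⟩, fun x hx => ?_, ?_⟩
  · have := c2 x (List.mem_of_mem_getLast? hx)
    have := d3 y hy
    omega
  · rcases List.mem_append.1 hx with h | h
    exacts [c2 x h, d2 x h]
  · cases c with
    | nil => simpa using d3
    | cons x c => simpa using c3

theorem IsSparse.flatten {L : List (List ℕ)} (hL : ∀ c ∈ L, IsSparse c) :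
    IsSparse L.flatten := by
  induction L with
  | nil => simp [IsSparse]
  | cons c L ih =>
    rw [List.flatten_cons]
    exact (hL c (by simp)).append (ih fun d hd => hL d (by simp [hd]))

theorem isSparse_replicate_two_append_three (k : ℕ) :
    IsSparse (List.replicate (k + 1) 2 ++ [3]) := by
  induction k with
  | zero => simp [IsSparse]
  | succ k ih => exact IsSparse.append (c := [2]) (by simp [IsSparse]) ih

theorem isSparse_blockA_succ (k : ℕ) : IsSparse (blockA (k + 1)) :=
  IsSparse.flatten fun c hc => by
    rw [List.eq_of_mem_replicate hc]
    exact isSparse_replicate_two_append_three k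

theorem flatten_map_blockA_succ (n : ℕ) :
    ∃ t, (((List.range (n + 1)).map blockA).flatten) = [3, 3, 3] ++ t ∧ IsSparse t := by
  refine ⟨_, ?_, IsSparse.flatten (L := (List.range n).map fun k => blockA (k + 1)) ?_⟩
  · rw [List.range_succ_eq_map, List.map_cons, List.map_map]
    rfl
  · intro c hc
    obtain ⟨k, -, rfl⟩ := List.mem_map.1 hc
    exact isSparse_blockA_succ k

theorem length_blockA (k : ℕ) : (blockA k).length = 3 * (k + 1) := by
  simp [blockA]
  omega

theorem le_length_flatten_map_blockA (n : ℕ) :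
    n ≤ ((List.range n).map blockA).flatten.length := by
  induction n with
  | zero => simp
  | succ n ih =>
    rw [List.range_succ, List.map_append, List.flatten_append, List.length_append]
    simp only [List.map_cons, List.map_nil, List.flatten_cons, List.flatten_nil, List.append_nil,
      length_blockA]
    omega

theorem length_aPrefix (l : ℕ) : (aPrefix l).length = l := by
  rw [aPrefix, List.length_take]
  exact min_eq_left (le_length_flatten_map_blockA l)

theorem bPrefix_eq_map (l : ℕ) : bPrefix l = (aPrefix l).map (4 - ·) := by
  have h : blockB = fun k => (blockA k).map (4 - ·) := by
    funext k
    simp [blockA, blockB]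
  rw [bPrefix, aPrefix, List.map_take, List.map_flatten, List.map_map, h]
  rfl

theorem length_bPrefix (l : ℕ) : (bPrefix l).length = l := by
  rw [bPrefix_eq_map, List.length_map, length_aPrefix]

theorem mem_aPrefix {l x : ℕ} (hx : x ∈ aPrefix l) : x = 2 ∨ x = 3 := by
  obtain ⟨c, hc, hx⟩ := List.mem_flatten.1 (List.mem_of_mem_take hx)
  obtain ⟨k, -, rfl⟩ := List.mem_map.1 hc
  obtain ⟨d, hd, hx⟩ := List.mem_flatten.1 hx
  rw [List.eq_of_mem_replicate hd] at hx
  simp at hx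
  omega

theorem mem_bPrefix {l x : ℕ} (hx : x ∈ bPrefix l) : x ≤ 2 := by
  rw [bPrefix_eq_map] at hx
  obtain ⟨y, hy, rfl⟩ := List.mem_map.1 hx
  have := mem_aPrefix hy
  omega

theorem length_spiralCode (l : ℕ) : (spiralCode l).length = 2 * l + 2 := by
  simp [spiralCode, length_aPrefix, length_bPrefix]
  omega

theorem sum_add_sum_map_four_sub (c : List ℕ) (hc : ∀ x ∈ c, x ≤ 4) :
    c.sum + (c.map (4 - ·)).sum = 4 * c.length := by
  induction c with
  | nil => rfl
  | cons x c ih =>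
    have := hc x (by simp)
    have := ih fun y hy => hc y (by simp [hy])
    simp only [List.map_cons, List.sum_cons, List.length_cons]
    omega

theorem sum_spiralCode (l : ℕ) : (spiralCode l).sum = 4 * l + 10 := by
  have h := sum_add_sum_map_four_sub (aPrefix l) fun x hx => by
    have := mem_aPrefix hx
    omega
  rw [← bPrefix_eq_map, length_aPrefix] at h
  simp only [spiralCode, List.sum_append, List.sum_cons, List.sum_reverse]
  omega

theorem sum_cwin_add_sum_drop (c : List ℕ) (i m : ℕ) :
    (cwin c i m).sum + ((c.rotate i).drop m).sum = c.sum := by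
  rw [cwin, ← List.sum_append, List.take_append_drop, (List.rotate_perm c i).sum_eq]

theorem cwin_length_sub (c : List ℕ) {m : ℕ} (hm : m ≤ c.length) :
    cwin c (c.length - m) m = c.drop (c.length - m) := by
  rw [cwin, List.rotate_eq_drop_append_take (by omega), List.take_append_of_le_length (by simp; omega),
    List.take_of_length_le (by simp; omega)]

theorem not_kConvex_of_drop {c : List ℕ} {k : ℕ} (hk : k + 1 ≤ c.length)
    (h : (c.drop (c.length - (k + 1))).sum < 2 * (k + 1)) : ¬ KConvex c k := by
  intro hc
  have := hc (c.length - (k + 1)) (by omega) hk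
  rw [cwin_length_sub c hk] at this
  omega

theorem aPrefix_eq_cons {l : ℕ} (hl : 1 ≤ l) : ∃ t, aPrefix l = 3 :: t := by
  obtain ⟨n, rfl⟩ := Nat.exists_eq_add_of_le' hl
  obtain ⟨t, ht, -⟩ := flatten_map_blockA_succ n
  exact ⟨_, by rw [aPrefix, ht]; rfl⟩

theorem aPrefix_eq_of_five_le {l : ℕ} (hl : 5 ≤ l) :
    ∃ t, aPrefix l = [3, 3, 3, 2, 3] ++ t := by
  obtain ⟨n, rfl⟩ := Nat.exists_eq_add_of_le' hl
  refine ⟨([2, 3, 2, 3] ++ (((((List.range (n + 3)).map Nat.succ).map Nat.succ).map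
    blockA).flatten)).take n, ?_⟩
  rw [aPrefix, List.range_succ_eq_map, List.range_succ_eq_map]
  rfl

theorem sum_drop_spiralCode_of_le {l m : ℕ} (hm : 1 ≤ m) (hl : m ≤ l) :
    ((spiralCode l).drop (2 * l + 2 - m)).sum < 2 * m := by
  have h : (spiralCode l).drop (2 * l + 2 - m) = ((bPrefix l).take m).reverse := by
    have e : 2 * l + 2 - m = (5 :: aPrefix l ++ [5]).length + (l - m) := by
      simp [length_aPrefix]
      omega
    have e' : spiralCode l = (5 :: aPrefix l ++ [5]) ++ (bPrefix l).reverse := by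
      simp [spiralCode]
    rw [e, e', List.drop_append, List.reverse_take, length_bPrefix]
    simp
  rw [h, List.sum_reverse]
  obtain ⟨t, ht⟩ := aPrefix_eq_cons (hm.trans hl)
  have hb : bPrefix l = 1 :: t.map (4 - ·) := by
    rw [bPrefix_eq_map, ht]
    rfl
  obtain ⟨k, rfl⟩ := Nat.exists_eq_add_of_le' hm
  have hs := List.sum_le_card_nsmul ((t.map (4 - ·)).take k) 2 fun x hx =>
    mem_bPrefix (l := l) (by rw [hb]; exact List.mem_cons_of_mem _ (List.mem_of_mem_take hx))
  have hk := List.length_take_le k (t.map (4 - ·))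
  rw [hb, List.take_succ_cons, List.sum_cons]
  rw [smul_eq_mul] at hs
  omega

theorem sum_drop_spiralCode_of_lt {l m : ℕ} (hl : l < m) (hm : m ≤ 2 * l - 4) :
    ((spiralCode l).drop (2 * l + 2 - m)).sum < 2 * m := by
  have h := congrArg List.sum (List.take_append_drop (2 * l + 2 - m) (spiralCode l))
  rw [List.sum_append, sum_spiralCode] at h
  obtain ⟨k, hk⟩ : ∃ k, 2 * l + 2 - m = k + 6 := ⟨2 * l - 4 - m, by omega⟩
  obtain ⟨t, ht⟩ := aPrefix_eq_of_five_le (l := l) (by omega)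
  have htl : t.length + 5 = l := by
    have := length_aPrefix l
    rw [ht] at this
    simpa using this
  have e : (spiralCode l).take (k + 6) = [5, 3, 3, 3, 2, 3] ++ t.take k := by
    simp [spiralCode, ht, List.take_append, show k - t.length = 0 by omega]
  have hs := List.card_nsmul_le_sum (t.take k) 2 fun x hx => by
    have := mem_aPrefix (l := l) (x := x) (by
      rw [ht]; exact List.mem_append_right _ (List.mem_of_mem_take hx))
    omega
  rw [List.length_take, min_eq_left (by omega), smul_eq_mul] at hs
  rw [hk, e, List.sum_append] at h
  rw [hk]
  simp at h
  omega

theorem aPrefix_window_sum_le {l i : ℕ} (hi : i + 3 < l) :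
    (aPrefix l)[i]'(by rw [length_aPrefix]; omega) +
      (aPrefix l)[i + 1]'(by rw [length_aPrefix]; omega) +
      (aPrefix l)[i + 2]'(by rw [length_aPrefix]; omega) +
      (aPrefix l)[i + 3]'(by rw [length_aPrefix]; omega) ≤ 11 := by
  have hmem : ∀ j (hj : j < (aPrefix l).length), (aPrefix l)[j] ≤ 3 := fun j hj => by
    have := mem_aPrefix (List.getElem_mem hj)
    omega
  have h0 := hmem i (by rw [length_aPrefix]; omega)
  have h1 := hmem (i + 1) (by rw [length_aPrefix]; omega)
  have h : (aPrefix l)[i + 2]'(by rw [length_aPrefix]; omega) +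
      (aPrefix l)[i + 3]'(by rw [length_aPrefix]; omega) ≤ 5 := by
    obtain ⟨n, rfl⟩ := Nat.exists_eq_add_of_le' (show 1 ≤ l by omega)
    obtain ⟨t, ht, h1, -, h3⟩ := flatten_map_blockA_succ n
    have hc : List.IsChain (fun x y => x + y ≤ 5) (3 :: t) := by
      rw [List.isChain_cons]
      exact ⟨fun y hy => by rw [h3 y hy], h1⟩
    rw [List.isChain_iff_getElem] at hc
    have hlen := le_length_flatten_map_blockA (n + 1)
    rw [ht] at hlen
    have := hc i (by simp at hlen ⊢; omega)
    simpa [aPrefix, ht] using this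
  omega

theorem sum_eq_of_length_eq_five {d : List ℕ} (hd : d.length = 5) :
    d.sum = d.getD 0 0 + d.getD 1 0 + d.getD 2 0 + d.getD 3 0 + d.getD 4 0 := by
  match d, hd with
  | [x, y, z, u, v], _ => simp; omega

theorem spiralCode_getD_add_one {l i : ℕ} (hi : i < l) :
    (spiralCode l).getD (i + 1) 0 = (aPrefix l)[i]'(by rw [length_aPrefix]; exact hi) := by
  rw [spiralCode, List.cons_append, List.getD_cons_succ,
    List.getD_append _ _ _ _ (by rw [length_aPrefix]; exact hi), List.getD_eq_getElem]

theorem spiralCode_getD_cases {l p : ℕ} (hp : p < 2 * l + 2) :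
    (spiralCode l).getD p 0 ≤ 2 ∨ (p = 0 ∨ p = l + 1) ∧ (spiralCode l).getD p 0 = 5 ∨
      1 ≤ p ∧ p ≤ l ∧ (spiralCode l).getD p 0 = 3 := by
  rcases Nat.eq_zero_or_pos p with rfl | h0
  · exact Or.inr (Or.inl ⟨Or.inl rfl, rfl⟩)
  obtain ⟨i, rfl⟩ := Nat.exists_eq_add_of_le' h0
  by_cases h : i < l
  · rw [spiralCode_getD_add_one h]
    have := mem_aPrefix (List.getElem_mem (l := aPrefix l) (by rw [length_aPrefix]; exact h))
    omega
  · have e : (spiralCode l).getD (i + 1) 0 = (5 :: (bPrefix l).reverse).getD (i - l) 0 := by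
      rw [spiralCode, List.cons_append, List.getD_cons_succ,
        List.getD_append_right _ _ _ _ (by rw [length_aPrefix]; omega), length_aPrefix]
    rw [e]
    rcases Nat.eq_zero_or_pos (i - l) with h' | h'
    · rw [h', List.getD_cons_zero]
      omega
    · obtain ⟨j, hj⟩ := Nat.exists_eq_add_of_le' h'
      have hlt : j < (bPrefix l).reverse.length := by
        rw [List.length_reverse, length_bPrefix]
        omega
      rw [hj, List.getD_cons_succ, List.getD_eq_getElem _ _ hlt]
      exact Or.inl (mem_bPrefix (List.mem_reverse.1 (List.getElem_mem hlt)))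

theorem spiralCode_window_sum_le {l p : ℕ} (h1 : 1 ≤ p) (hp : p + 3 ≤ l) :
    (spiralCode l).getD p 0 + (spiralCode l).getD (p + 1) 0 +
      (spiralCode l).getD (p + 2) 0 + (spiralCode l).getD (p + 3) 0 ≤ 11 := by
  obtain ⟨i, rfl⟩ := Nat.exists_eq_add_of_le' h1
  have h := aPrefix_window_sum_le (l := l) (i := i) (by omega)
  rwa [← spiralCode_getD_add_one (by omega), ← spiralCode_getD_add_one (by omega),
    ← spiralCode_getD_add_one (by omega), ← spiralCode_getD_add_one (by omega)] at h

theorem add_mod_cases {s n : ℕ} (hs : s < n) {j : ℕ} (hj : j < n) :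
    s + j < n ∧ (s + j) % n = s + j ∨ n ≤ s + j ∧ (s + j) % n = s + j - n := by
  rcases lt_or_ge (s + j) n with h | h
  · exact Or.inl ⟨h, Nat.mod_eq_of_lt h⟩
  · refine Or.inr ⟨h, ?_⟩
    rw [Nat.mod_eq_sub_mod h, Nat.mod_eq_of_lt (by omega)]

theorem spiralCode_cyclic_five_sum_le {l s : ℕ} (hl : 4 ≤ l) (hs : s < 2 * l + 2) :
    (spiralCode l).getD s 0 + (spiralCode l).getD ((s + 1) % (2 * l + 2)) 0 +
      (spiralCode l).getD ((s + 2) % (2 * l + 2)) 0 +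
      (spiralCode l).getD ((s + 3) % (2 * l + 2)) 0 +
      (spiralCode l).getD ((s + 4) % (2 * l + 2)) 0 ≤ 16 := by
  have c0 := spiralCode_getD_cases hs
  have c1 := spiralCode_getD_cases (l := l) (Nat.mod_lt (s + 1) (by omega))
  have c2 := spiralCode_getD_cases (l := l) (Nat.mod_lt (s + 2) (by omega))
  have c3 := spiralCode_getD_cases (l := l) (Nat.mod_lt (s + 3) (by omega))
  have c4 := spiralCode_getD_cases (l := l) (Nat.mod_lt (s + 4) (by omega))
  by_cases h : s + 4 < 2 * l + 2
  · rw [Nat.mod_eq_of_lt (show s + 1 < 2 * l + 2 by omega)] at *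
    rw [Nat.mod_eq_of_lt (show s + 2 < 2 * l + 2 by omega)] at *
    rw [Nat.mod_eq_of_lt (show s + 3 < 2 * l + 2 by omega)] at *
    rw [Nat.mod_eq_of_lt h] at *
    rcases Nat.eq_zero_or_pos s with rfl | h0
    · have := spiralCode_window_sum_le (l := l) (p := 1) le_rfl (by omega)
      simp only [zero_add, Nat.reduceAdd] at *
      omega
    · by_cases h' : s + 3 ≤ l
      · have := spiralCode_window_sum_le h0 h'
        omega
      · omega
  · have m1 := add_mod_cases hs (j := 1) (by omega)
    have m2 := add_mod_cases hs (j := 2) (by omega)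
    have m3 := add_mod_cases hs (j := 3) (by omega)
    have m4 := add_mod_cases hs (j := 4) (by omega)
    generalize (s + 1) % (2 * l + 2) = q1 at *
    generalize (s + 2) % (2 * l + 2) = q2 at *
    generalize (s + 3) % (2 * l + 2) = q3 at *
    generalize (s + 4) % (2 * l + 2) = q4 at *
    omega

theorem sum_drop_rotate_spiralCode_le {l : ℕ} (hl : 4 ≤ l) (i : ℕ) :
    (((spiralCode l).rotate i).drop (2 * l - 3)).sum ≤ 16 := by
  have hlen := length_spiralCode l
  have hd : (((spiralCode l).rotate i).drop (2 * l - 3)).length = 5 := by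
    rw [List.length_drop, List.length_rotate, hlen]
    omega
  have hget : ∀ j < 5, (((spiralCode l).rotate i).drop (2 * l - 3)).getD j 0 =
      (spiralCode l).getD (((2 * l - 3 + i) % (2 * l + 2) + j) % (2 * l + 2)) 0 := by
    intro j hj
    rw [List.getD_eq_getElem _ _ (by omega), List.getD_eq_getElem _ _ (by
      rw [hlen]; exact Nat.mod_lt _ (by omega)), List.getElem_drop, List.getElem_rotate]
    congr 1
    rw [hlen, Nat.mod_add_mod]
    congr 1
    omega
  have hs : (2 * l - 3 + i) % (2 * l + 2) < 2 * l + 2 := Nat.mod_lt _ (by omega)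
  rw [sum_eq_of_length_eq_five hd, hget 0 (by omega), hget 1 (by omega), hget 2 (by omega),
    hget 3 (by omega), hget 4 (by omega), add_zero, Nat.mod_mod]
  exact spiralCode_cyclic_five_sum_le hl hs

theorem kConvex_spiralCode (l : ℕ) : KConvex (spiralCode l) (max l (2 * l - 4)) := by
  rcases Nat.lt_or_ge l 4 with hl | hl
  · interval_cases l <;> unfold KConvex <;> decide
  · intro i _ _
    have h := sum_cwin_add_sum_drop (spiralCode l) i (2 * l - 3)
    have := sum_drop_rotate_spiralCode_le hl i
    rw [sum_spiralCode] at h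
    rw [show max l (2 * l - 4) + 1 = 2 * l - 3 by omega]
    omega

theorem not_kConvex_spiralCode {l k : ℕ} (hk : k < max l (2 * l - 4)) :
    ¬ KConvex (spiralCode l) k := by
  have hlen := length_spiralCode l
  refine not_kConvex_of_drop (by omega) ?_
  rw [hlen]
  rcases Nat.lt_or_ge k l with h | h
  · exact sum_drop_spiralCode_of_le (by omega) h
  · exact sum_drop_spiralCode_of_lt (by omega) (by omega)

/-- For every `h ≥ 2`, the convexity deficit of the boundary-edges code
`w (h - 2)` of the spiral benzenoid `S h` equals `max {h - 2, 2h - 8}`. -/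
theorem cd_spiralCode (h : ℕ) (hh : 2 ≤ h) :
    cd (spiralCode (h - 2)) = max (h - 2) (2 * h - 8) := by
  rw [show 2 * h - 8 = 2 * (h - 2) - 4 by omega]
  have hc := kConvex_spiralCode (h - 2)
  refine le_antisymm (Nat.sInf_le hc) (le_csInf ⟨_, hc⟩ fun k hk => ?_)
  by_contra! hlt
  exact not_kConvex_spiralCode hlt hk
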